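/- Let α ∈ (1/2, 1) ∪ (1, ∞), let p ∈ Δ_n satisfy p[j] > 0 for all j, and assume Σ_{j=1}^n p[j] W(j)^α is positive definite. Define F(Q) := (Σ_{j=1}^n p[j] W(j)^α / Tr[W(j)^α Q^{1−α}])^{1/α} on positive definite matrices, let Q* be a positive definite matrix with F(Q*) = Q*, let Q_1 be positive definite, and set Q_{t+1} := F(Q_t) for t ≥ 1. Then for every T ≥ 1, |Σ_{j=1}^n p[j] D_α(W(j)‖Q_{T+1}) − Σ_{j=1}^n p[j] D_α(W(j)‖Q*)| ≤ (1/|1−α|) · (|1−α|/α)^T · d_T(Q_1^{1−α}, (Q*)^{1−α}). -/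

import Mathlib

open Matrix
open scoped ComplexOrder

/-- Matrix power of a Hermitian matrix, defined by applying `t ↦ t ^ r` (real `rpow`)
to the eigenvalues in a spectral decomposition. Returns `0` on non-Hermitian input. -/
noncomputable def matRpow {d : ℕ} (A : Matrix (Fin d) (Fin d) ℂ) (r : ℝ) :
    Matrix (Fin d) (Fin d) ℂ :=
  if hA : A.IsHermitian then
    (hA.eigenvectorUnitary : Matrix (Fin d) (Fin d) ℂ) *
      Matrix.diagonal (fun i => ((hA.eigenvalues i ^ r : ℝ) : ℂ)) *
      (star hA.eigenvectorUnitary : Matrix (Fin d) (Fin d) ℂ)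
  else 0

/-- Loewner order: `A ⪯ B` iff `B - A` is positive semidefinite. -/
def loewnerLE {d : ℕ} (A B : Matrix (Fin d) (Fin d) ℂ) : Prop := (B - A).PosSemidef

/-- Thompson metric on positive definite matrices. -/
noncomputable def thompsonDist {d : ℕ} (V U : Matrix (Fin d) (Fin d) ℂ) : ℝ :=
  sInf {r : ℝ | 0 ≤ r ∧ loewnerLE (Real.exp (-r) • V) U ∧ loewnerLE U (Real.exp r • V)}

/-- Petz–Rényi divergence `D_α(A‖Q) = (1/(α-1)) log Tr[A^α Q^{1-α}]`. -/
noncomputable def petzRenyiDiv {d : ℕ} (α : ℝ) (A Q : Matrix (Fin d) (Fin d) ℂ) : ℝ :=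
  (1 / (α - 1)) * Real.log ((matRpow A α * matRpow Q (1 - α)).trace).re

/-- The fixed-point map `F(Q) = (∑ⱼ p[j] W(j)^α / Tr[W(j)^α Q^{1-α}])^{1/α}`. -/
noncomputable def augFixedPointMap {n d : ℕ} (α : ℝ) (W : Fin n → Matrix (Fin d) (Fin d) ℂ)
    (p : Fin n → ℝ) (Q : Matrix (Fin d) (Fin d) ℂ) : Matrix (Fin d) (Fin d) ℂ :=
  matRpow (∑ j, (p j / ((matRpow (W j) α * matRpow Q (1 - α)).trace).re) • matRpow (W j) α)
    (1 / α)

section Aux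
open scoped MatrixOrder Matrix.Norms.L2Operator

variable {d : ℕ}

theorem aux_matRpow_eq {A : Matrix (Fin d) (Fin d) ℂ} (hA : A.PosSemidef) (r : ℝ) :
    matRpow A r = A ^ r := by
  rw [CFC.rpow_eq_cfc_real hA.nonneg, hA.1.cfc_eq, matRpow, dif_pos hA.1, Matrix.IsHermitian.cfc,
    Unitary.conjStarAlgAut_apply]
  rfl

theorem aux_rpow_sp {A : Matrix (Fin d) (Fin d) ℂ} (hA : A.PosDef) (r : ℝ) :
    (A ^ r).PosDef := by
  have h := hA.isStrictlyPositive
  apply IsStrictlyPositive.posDef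
  rw [IsStrictlyPositive.iff_of_unital]
  exact ⟨CFC.rpow_nonneg, h.isUnit.cfcRpow r h.nonneg⟩

theorem aux_smul_rpow {A : Matrix (Fin d) (Fin d) ℂ} (hA : A.PosDef) {c : ℝ} (hc : 0 < c) (r : ℝ) :
    (c • A) ^ r = (c ^ r) • A ^ r := by
  have h := hA.isStrictlyPositive
  have hs : ∀ x ∈ spectrum ℝ A, 0 < x := fun x hx => h.spectrum_pos hx
  have hco : ContinuousOn (fun x : ℝ => x ^ r) (spectrum ℝ A) := fun x hx =>
    (Real.continuousAt_rpow_const x r (Or.inl (hs x hx).ne')).continuousWithinAt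
  have hsa : IsSelfAdjoint A := h.isSelfAdjoint
  have h1 : c • A = cfc (fun x : ℝ => c * x) A := by
    rw [cfc_const_mul_id c A]
  rw [h1, CFC.cfc_rpow (fun x hx => mul_pos hc (hs x hx)), CFC.rpow_eq_cfc_real h.nonneg,
    ← cfc_const_mul _ _ _ hco]
  exact cfc_congr fun x hx => Real.mul_rpow hc.le (hs x hx).le

theorem aux_rpow_mono {A B : Matrix (Fin d) (Fin d) ℂ} (hAB : A ≤ B) {r : ℝ} (h0 : 0 ≤ r)
    (h1 : r ≤ 1) : A ^ r ≤ B ^ r := CFC.rpow_le_rpow ⟨h0, h1⟩ hAB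

theorem aux_rpow_anti {A B : Matrix (Fin d) (Fin d) ℂ} (hA : A.PosDef) (hB : B.PosDef)
    (hAB : A ≤ B) {r : ℝ} (h0 : 0 < r)
    (h1 : r ≤ 1) : B ^ (-r) ≤ A ^ (-r) := by
  have e : -r = r * (-1) := by ring
  rw [e, ← CFC.rpow_rpow A r (-1) h0.ne' hA.isStrictlyPositive,
    ← CFC.rpow_rpow B r (-1) h0.ne' hB.isStrictlyPositive]
  exact CStarAlgebra.rpow_neg_one_le_rpow_neg_one (aux_rpow_mono hAB h0.le h1)
    (aux_rpow_sp hA r).isStrictlyPositive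

/-- contraction of powers -/
theorem aux_contr {A B : Matrix (Fin d) (Fin d) ℂ} (hA : A.PosDef) (hB : B.PosDef) {s g : ℝ}
    (h1 : Real.exp (-s) • A ≤ B) (h2 : B ≤ Real.exp s • A) (hg0 : g ≠ 0) (hg : |g| ≤ 1) :
    Real.exp (-(|g| * s)) • A ^ g ≤ B ^ g ∧ B ^ g ≤ Real.exp (|g| * s) • A ^ g := by
  have p1 : (Real.exp (-s) • A).PosDef := hA.smul (Real.exp_pos _)
  have p2 : (Real.exp s • A).PosDef := hA.smul (Real.exp_pos _)
  rcases lt_or_gt_of_ne hg0 with h | h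
  · rw [abs_of_neg h] at *
    have k1 := aux_rpow_anti p1 hB h1 (neg_pos.2 h) hg
    have k2 := aux_rpow_anti hB p2 h2 (neg_pos.2 h) hg
    rw [neg_neg, aux_smul_rpow hA (Real.exp_pos _), ← Real.exp_mul] at k1 k2
    constructor
    · convert k2 using 3; ring
    · convert k1 using 3; ring
  · rw [abs_of_pos h] at *
    have k1 := aux_rpow_mono h1 h.le hg
    have k2 := aux_rpow_mono h2 h.le hg
    rw [aux_smul_rpow hA (Real.exp_pos _), ← Real.exp_mul] at k1 k2
    constructor
    · convert k1 using 3; ring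
    · convert k2 using 3; ring

theorem aux_trace_nonneg {A B : Matrix (Fin d) (Fin d) ℂ} (hA : A.PosSemidef) (hB : B.PosSemidef) :
    0 ≤ ((A * B).trace).re := by
  obtain ⟨C, rfl⟩ := CStarAlgebra.nonneg_iff_eq_star_mul_self.mp hA.nonneg
  have h : (star C * C * B).trace = (C * B * Cᴴ).trace := by
    rw [mul_assoc, Matrix.trace_mul_comm]; rfl
  rw [h]
  exact (Complex.le_def.1 (hB.mul_mul_conjTranspose_same C).trace_nonneg).1

theorem aux_trace_mono {A B C : Matrix (Fin d) (Fin d) ℂ} (hA : A.PosSemidef) (hB : B ≤ C) :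
    ((A * B).trace).re ≤ ((A * C).trace).re := by
  have := aux_trace_nonneg hA (Matrix.le_iff.1 hB)
  rw [mul_sub, Matrix.trace_sub, Complex.sub_re] at this
  linarith

theorem aux_trace_smul {A B : Matrix (Fin d) (Fin d) ℂ} (c : ℝ) :
    ((A * (c • B)).trace).re = c * ((A * B).trace).re := by
  rw [mul_smul_comm, Matrix.trace_smul, Complex.smul_re, smul_eq_mul]

theorem aux_lower {V : Matrix (Fin d) (Fin d) ℂ} (hd : 0 < d) (hV : V.PosDef) :
    ∃ c : ℝ, 0 < c ∧ c • (1 : Matrix (Fin d) (Fin d) ℂ) ≤ V := by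
  haveI : Nonempty (Fin d) := ⟨⟨0, hd⟩⟩
  have h := hV.isStrictlyPositive
  obtain ⟨r, hr, hr'⟩ := (CFC.exists_pos_algebraMap_le_iff (A := Matrix (Fin d) (Fin d) ℂ)
    h.isSelfAdjoint).2 fun x hx ↦ h.spectrum_pos hx
  exact ⟨r, hr, by rwa [Algebra.algebraMap_eq_smul_one] at hr'⟩

theorem aux_upper {V : Matrix (Fin d) (Fin d) ℂ} (hV : V.PosDef) :
    ∃ c : ℝ, 0 < c ∧ V ≤ c • (1 : Matrix (Fin d) (Fin d) ℂ) := by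
  refine ⟨‖V‖ + 1, by positivity, ?_⟩
  have h := hV.isStrictlyPositive
  have := IsSelfAdjoint.le_algebraMap_norm_self h.isSelfAdjoint
  rw [Algebra.algebraMap_eq_smul_one] at this
  rw [add_smul, one_smul]
  exact this.trans (le_add_of_nonneg_right zero_le_one)

theorem aux_trace_pos {A V : Matrix (Fin d) (Fin d) ℂ} (hd : 0 < d) (hA : A.PosSemidef)
    (hA0 : A ≠ 0) (hV : V.PosDef) : 0 < ((A * V).trace).re := by
  obtain ⟨c, hc, h⟩ := aux_lower hd hV
  have h1 := aux_trace_mono hA h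
  rw [aux_trace_smul, mul_one] at h1
  have h2 : 0 ≤ A.trace := hA.trace_nonneg
  have h3 : A.trace ≠ 0 := fun h => hA0 (hA.trace_eq_zero_iff.1 h)
  have h4 := (Complex.lt_def.1 (lt_of_le_of_ne h2 h3.symm)).1
  exact lt_of_lt_of_le (mul_pos hc h4) h1

theorem aux_exists {V U : Matrix (Fin d) (Fin d) ℂ} (hd : 0 < d) (hV : V.PosDef) (hU : U.PosDef) :
    ∃ r : ℝ, 0 ≤ r ∧ Real.exp (-r) • V ≤ U ∧ U ≤ Real.exp r • V := by
  obtain ⟨c, hc, hcV⟩ := aux_lower hd hV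
  obtain ⟨c', hc', hcU⟩ := aux_lower hd hU
  obtain ⟨b, hb, hbV⟩ := aux_upper hV
  obtain ⟨b', hb', hbU⟩ := aux_upper hU
  have key : ∀ {V U : Matrix (Fin d) (Fin d) ℂ} {c b r : ℝ}, 0 < c → 0 < b →
      c • (1 : Matrix (Fin d) (Fin d) ℂ) ≤ V → U ≤ b • (1 : Matrix (Fin d) (Fin d) ℂ) →
      b / c ≤ Real.exp r → U ≤ Real.exp r • V := by
    intro V U c b r hc hb h1 h2 hr
    refine h2.trans (le_trans ?_ (smul_le_smul_of_nonneg_left h1 (Real.exp_pos r).le))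
    rw [smul_smul]
    exact smul_le_smul_of_nonneg_right ((div_le_iff₀ hc).1 hr) zero_le_one
  have hr1 : b' / c ≤ Real.exp (b' / c + b / c') := by
    have := Real.add_one_le_exp (b' / c + b / c')
    have : 0 < b / c' := by positivity
    linarith
  have hr2 : b / c' ≤ Real.exp (b' / c + b / c') := by
    have := Real.add_one_le_exp (b' / c + b / c')
    have : 0 < b' / c := by positivity
    linarith
  refine ⟨b' / c + b / c', by positivity, ?_, key hc hb' hcV hbU hr1⟩
  have := smul_le_smul_of_nonneg_left (key hc' hb hcU hbV hr2)
    (Real.exp_pos (-(b' / c + b / c'))).le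
  rwa [smul_smul, ← Real.exp_add, neg_add_cancel, Real.exp_zero, one_smul] at this

/-- the inner sum -/
noncomputable def auxS {n : ℕ} (p : Fin n → ℝ) (X : Fin n → Matrix (Fin d) (Fin d) ℂ)
    (V : Matrix (Fin d) (Fin d) ℂ) : Matrix (Fin d) (Fin d) ℂ :=
  ∑ j, (p j / ((X j * V).trace).re) • X j

theorem aux_smul_le {A : Matrix (Fin d) (Fin d) ℂ} (hA : A.PosSemidef) {a b : ℝ} (h : a ≤ b) :
    a • A ≤ b • A := smul_le_smul_of_nonneg_right h hA.nonneg

theorem auxS_mono {n : ℕ} (hd : 0 < d) {p : Fin n → ℝ} (hp : ∀ j, 0 < p j)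
    {X : Fin n → Matrix (Fin d) (Fin d) ℂ} (hX : ∀ j, (X j).PosSemidef) (hX0 : ∀ j, X j ≠ 0)
    {V U : Matrix (Fin d) (Fin d) ℂ} (hV : V.PosDef) (hU : U.PosDef) {c : ℝ} (hc : 0 < c)
    (h : V ≤ c • U) : auxS p X U ≤ c • auxS p X V := by
  unfold auxS
  rw [Finset.smul_sum]
  refine Finset.sum_le_sum fun j _ => ?_
  rw [smul_smul]
  apply aux_smul_le (hX j)
  have h1 := aux_trace_mono (hX j) h
  rw [aux_trace_smul] at h1
  have p1 := aux_trace_pos hd (hX j) (hX0 j) hV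
  have p2 := aux_trace_pos hd (hX j) (hX0 j) hU
  rw [← mul_div_assoc, div_le_div_iff₀ p2 p1]
  nlinarith [mul_le_mul_of_nonneg_left h1 (hp j).le]

theorem auxS_contr {n : ℕ} (hd : 0 < d) {p : Fin n → ℝ} (hp : ∀ j, 0 < p j)
    {X : Fin n → Matrix (Fin d) (Fin d) ℂ} (hX : ∀ j, (X j).PosSemidef) (hX0 : ∀ j, X j ≠ 0)
    {V U : Matrix (Fin d) (Fin d) ℂ} (hV : V.PosDef) (hU : U.PosDef) {s : ℝ}
    (h1 : Real.exp (-s) • V ≤ U) (h2 : U ≤ Real.exp s • V) :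
    Real.exp (-s) • auxS p X V ≤ auxS p X U ∧ auxS p X U ≤ Real.exp s • auxS p X V := by
  have flip : ∀ {A B : Matrix (Fin d) (Fin d) ℂ}, Real.exp (-s) • A ≤ B ↔ A ≤ Real.exp s • B := by
    intro A B
    constructor
    · intro h
      have := smul_le_smul_of_nonneg_left h (Real.exp_pos s).le
      rwa [smul_smul, ← Real.exp_add, add_neg_cancel, Real.exp_zero, one_smul] at this
    · intro h
      have := smul_le_smul_of_nonneg_left h (Real.exp_pos (-s)).le
      rwa [smul_smul, ← Real.exp_add, neg_add_cancel, Real.exp_zero, one_smul] at this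
  exact ⟨flip.2 (auxS_mono hd hp hX hX0 hU hV (Real.exp_pos s) h2),
    auxS_mono hd hp hX hX0 hV hU (Real.exp_pos s) (flip.1 h1)⟩

theorem auxS_posDef {n : ℕ} (hd : 0 < d) {p : Fin n → ℝ} (hp : ∀ j, 0 < p j)
    {X : Fin n → Matrix (Fin d) (Fin d) ℂ} (hX : ∀ j, (X j).PosSemidef) (hX0 : ∀ j, X j ≠ 0)
    (hPD : (∑ j, p j • X j).PosDef)
    {V : Matrix (Fin d) (Fin d) ℂ} (hV : V.PosDef) : (auxS p X V).PosDef := by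
  have hpos := fun j => aux_trace_pos hd (hX j) (hX0 j) hV
  have hne : 0 < 1 + ∑ i, ((X i * V).trace).re :=
    add_pos_of_pos_of_nonneg one_pos (Finset.sum_nonneg fun i _ => (hpos i).le)
  set K := 1 + ∑ i, ((X i * V).trace).re with hK
  have h : K⁻¹ • (∑ j, p j • X j) ≤ auxS p X V := by
    unfold auxS
    rw [Finset.smul_sum]
    refine Finset.sum_le_sum fun j _ => ?_
    rw [smul_smul]
    apply aux_smul_le (hX j)
    have : ((X j * V).trace).re ≤ K := by
      have := Finset.single_le_sum (f := fun i => ((X i * V).trace).re)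
        (fun i _ => (hpos i).le) (Finset.mem_univ j)
      linarith
    rw [mul_comm, ← div_eq_mul_inv]
    exact div_le_div_of_nonneg_left (hp j).le (hpos j) this
  have h3 : (K⁻¹ • (∑ j, p j • X j)).PosDef := hPD.smul (inv_pos.2 hne)
  have := h3.add_posSemidef (Matrix.le_iff.1 h)
  rwa [add_sub_cancel] at this

theorem aux_log {A V U : Matrix (Fin d) (Fin d) ℂ} (hd : 0 < d) (hA : A.PosSemidef)
    (hA0 : A ≠ 0) (hV : V.PosDef) {s : ℝ} (hU : U.PosDef)
    (h1 : Real.exp (-s) • V ≤ U) (h2 : U ≤ Real.exp s • V) :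
    |Real.log ((A * V).trace).re - Real.log ((A * U).trace).re| ≤ s := by
  have pV := aux_trace_pos hd hA hA0 hV
  have pU := aux_trace_pos hd hA hA0 hU
  have k1 := aux_trace_mono hA h1
  have k2 := aux_trace_mono hA h2
  rw [aux_trace_smul] at k1 k2
  have l1 := Real.log_le_log (mul_pos (Real.exp_pos _) pV) k1
  have l2 := Real.log_le_log pU k2
  rw [Real.log_mul (Real.exp_pos _).ne' pV.ne', Real.log_exp] at l1 l2
  rw [abs_le]
  constructor <;> linarith

theorem aux_rpow_ne_zero {A : Matrix (Fin d) (Fin d) ℂ} (hA : A.PosSemidef) (h : A ≠ 0) {r : ℝ}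
    (hr : 0 < r) : A ^ r ≠ 0 := by
  intro h0
  apply h
  have := CFC.rpow_rpow_of_exponent_nonneg A r r⁻¹ hr.le (inv_pos.2 hr).le hA.nonneg
  rw [mul_inv_cancel₀ hr.ne', CFC.rpow_one A hA.nonneg, h0] at this
  rw [← this]
  exact CFC.zero_rpow (inv_pos.2 hr).ne'

theorem aux_main {n : ℕ} (hd : 0 < d) (α : ℝ)
    (hα : α ∈ Set.Ioo (1 / 2 : ℝ) 1 ∪ Set.Ioi (1 : ℝ))
    (W : Fin n → Matrix (Fin d) (Fin d) ℂ)
    (hW : ∀ j, (W j).PosSemidef ∧ (W j).trace = 1)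
    (p : Fin n → ℝ) (hp : p ∈ stdSimplex ℝ (Fin n)) (hppos : ∀ j, 0 < p j)
    (hPD : (∑ j, p j • matRpow (W j) α).PosDef)
    (Qstar : Matrix (Fin d) (Fin d) ℂ) (hQstar : Qstar.PosDef)
    (hfix : augFixedPointMap α W p Qstar = Qstar)
    (Q : ℕ → Matrix (Fin d) (Fin d) ℂ) (hQ1 : (Q 1).PosDef)
    (hiter : ∀ t, 1 ≤ t → Q (t + 1) = augFixedPointMap α W p (Q t))
    (T : ℕ) :
    |(∑ j, p j * petzRenyiDiv α (W j) (Q (T + 1)))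
        - ∑ j, p j * petzRenyiDiv α (W j) Qstar|
      ≤ (1 / |1 - α|) * (|1 - α| / α) ^ T
          * thompsonDist (matRpow (Q 1) (1 - α)) (matRpow Qstar (1 - α)) := by
  have hα0 : 0 < α := by
    rcases hα with h | h
    · have := h.1; linarith
    · exact lt_trans one_pos h
  have hα1 : 1 - α ≠ 0 := by
    rcases hα with h | h
    · have := h.2; intro h; linarith
    · have : 1 < α := h
      intro h; linarith
  have habs : |1 - α| ≤ α := by
    rw [abs_le]
    rcases hα with h | h
    · have := h.1; constructor <;> linarith
    · have : 1 < α := h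
      constructor <;> linarith
  set X : Fin n → Matrix (Fin d) (Fin d) ℂ := fun j => matRpow (W j) α with hXdef
  have hX : ∀ j, (X j).PosSemidef := fun j => by
    simp only [hXdef]
    rw [aux_matRpow_eq (hW j).1]
    exact (CFC.rpow_nonneg (a := W j) (y := α)).posSemidef
  have hX0 : ∀ j, X j ≠ 0 := fun j => by
    simp only [hXdef]
    rw [aux_matRpow_eq (hW j).1]
    apply aux_rpow_ne_zero (hW j).1 _ hα0
    intro h
    have := (hW j).2
    rw [h] at this
    simp at this
  have hF : ∀ R, augFixedPointMap α W p R = matRpow (auxS p X (matRpow R (1 - α))) (1 / α) :=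
    fun R => rfl
  have hSp : ∀ {V : Matrix (Fin d) (Fin d) ℂ}, V.PosDef → (auxS p X V).PosDef :=
    fun hV => auxS_posDef hd hppos hX hX0 hPD hV
  have hVp : ∀ {R : Matrix (Fin d) (Fin d) ℂ}, R.PosDef → (matRpow R (1 - α)).PosDef := by
    intro R hR
    rw [aux_matRpow_eq hR.posSemidef]
    exact aux_rpow_sp hR _
  have hFp : ∀ {R : Matrix (Fin d) (Fin d) ℂ}, R.PosDef → (augFixedPointMap α W p R).PosDef := by
    intro R hR
    rw [hF, aux_matRpow_eq (hSp (hVp hR)).posSemidef]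
    exact aux_rpow_sp (hSp (hVp hR)) _
  have hFV : ∀ {R : Matrix (Fin d) (Fin d) ℂ}, R.PosDef →
      matRpow (augFixedPointMap α W p R) (1 - α)
        = (auxS p X (matRpow R (1 - α))) ^ ((1 - α) / α) := by
    intro R hR
    have hs := hSp (hVp hR)
    rw [aux_matRpow_eq (hFp hR).posSemidef, hF, aux_matRpow_eq hs.posSemidef,
      CFC.rpow_rpow _ _ _ (one_div_pos.2 hα0).ne' hs.isStrictlyPositive]
    congr 1
    field_simp
  have hQp : ∀ t, (Q (t + 1)).PosDef := by
    intro t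
    induction t with
    | zero => exact hQ1
    | succ t ih => rw [hiter (t + 1) (by omega)]; exact hFp ih
  have hg : |(1 - α) / α| = |1 - α| / α := by rw [abs_div, abs_of_pos hα0]
  have hg0 : (1 - α) / α ≠ 0 := div_ne_zero hα1 hα0.ne'
  have hg1 : |(1 - α) / α| ≤ 1 := by rw [hg, div_le_one hα0]; exact habs
  have step : ∀ r : ℝ, Real.exp (-r) • matRpow (Q 1) (1 - α) ≤ matRpow Qstar (1 - α) →
      matRpow Qstar (1 - α) ≤ Real.exp r • matRpow (Q 1) (1 - α) → ∀ t : ℕ,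
      Real.exp (-((|1 - α| / α) ^ t * r)) • matRpow (Q (t + 1)) (1 - α) ≤ matRpow Qstar (1 - α) ∧
      matRpow Qstar (1 - α) ≤ Real.exp ((|1 - α| / α) ^ t * r) • matRpow (Q (t + 1)) (1 - α) := by
    intro r h1 h2 t
    induction t with
    | zero => simpa using ⟨h1, h2⟩
    | succ t ih =>
      have k := auxS_contr hd hppos hX hX0 (hVp (hQp t)) (hVp hQstar) ih.1 ih.2
      have k2 := aux_contr (hSp (hVp (hQp t))) (hSp (hVp hQstar)) k.1 k.2 hg0 hg1
      rw [← hFV (hQp t), ← hFV hQstar, hfix, ← hiter (t + 1) (by omega), hg] at k2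
      rw [pow_succ', mul_assoc]
      exact k2
  have bound : ∀ r : ℝ, Real.exp (-r) • matRpow (Q 1) (1 - α) ≤ matRpow Qstar (1 - α) →
      matRpow Qstar (1 - α) ≤ Real.exp r • matRpow (Q 1) (1 - α) →
      |(∑ j, p j * petzRenyiDiv α (W j) (Q (T + 1)))
        - ∑ j, p j * petzRenyiDiv α (W j) Qstar| ≤ (1 / |1 - α|) * (|1 - α| / α) ^ T * r := by
    intro r h1 h2
    obtain ⟨k1, k2⟩ := step r h1 h2 T
    rw [← Finset.sum_sub_distrib]
    refine (Finset.abs_sum_le_sum_abs _ _).trans ?_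
    have : ∀ j, |p j * petzRenyiDiv α (W j) (Q (T + 1)) - p j * petzRenyiDiv α (W j) Qstar|
        ≤ p j * ((1 / |1 - α|) * (|1 - α| / α) ^ T * r) := by
      intro j
      rw [← mul_sub, abs_mul, abs_of_pos (hppos j)]
      refine mul_le_mul_of_nonneg_left ?_ (hppos j).le
      unfold petzRenyiDiv
      rw [← mul_sub, abs_mul, abs_div, abs_one, abs_sub_comm α 1, mul_assoc]
      exact mul_le_mul_of_nonneg_left
        (aux_log hd (hX j) (hX0 j) (hVp (hQp T)) (hVp hQstar) k1 k2) (by positivity)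
    refine (Finset.sum_le_sum fun j _ => this j).trans ?_
    rw [← Finset.sum_mul, hp.2, one_mul]
  have hC : 0 < (1 / |1 - α|) * (|1 - α| / α) ^ T := by
    have := abs_pos.2 hα1
    positivity
  rw [← div_le_iff₀' hC]
  unfold thompsonDist
  apply le_csInf
  · obtain ⟨r, hr⟩ := aux_exists hd (hVp hQ1) (hVp hQstar)
    exact ⟨r, hr⟩
  · rintro r ⟨-, h1, h2⟩
    rw [div_le_iff₀' hC]
    exact bound r h1 h2

end Aux

/-- convergence of the value estimates: the weighted sums of Petz–Rényi
divergences with respect to the iterates converge linearly to those with respect to the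
fixed point. -/
theorem aug_value_convergence {n d : ℕ} (hn : 0 < n) (hd : 0 < d) (α : ℝ)
    (hα : α ∈ Set.Ioo (1 / 2 : ℝ) 1 ∪ Set.Ioi (1 : ℝ))
    (W : Fin n → Matrix (Fin d) (Fin d) ℂ)
    (hW : ∀ j, (W j).PosSemidef ∧ (W j).trace = 1)
    (p : Fin n → ℝ) (hp : p ∈ stdSimplex ℝ (Fin n)) (hppos : ∀ j, 0 < p j)
    (hPD : (∑ j, p j • matRpow (W j) α).PosDef)
    (Qstar : Matrix (Fin d) (Fin d) ℂ) (hQstar : Qstar.PosDef)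
    (hfix : augFixedPointMap α W p Qstar = Qstar)
    (Q : ℕ → Matrix (Fin d) (Fin d) ℂ) (hQ1 : (Q 1).PosDef)
    (hiter : ∀ t, 1 ≤ t → Q (t + 1) = augFixedPointMap α W p (Q t))
    (T : ℕ) (hT : 1 ≤ T) :
    |(∑ j, p j * petzRenyiDiv α (W j) (Q (T + 1)))
        - ∑ j, p j * petzRenyiDiv α (W j) Qstar|
      ≤ (1 / |1 - α|) * (|1 - α| / α) ^ T
          * thompsonDist (matRpow (Q 1) (1 - α)) (matRpow Qstar (1 - α)) := by
  exact aux_main hd α hα W hW p hp hppos hPD Qstar hQstar hfix Q hQ1 hiter T
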